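/- Let λ > 0, X ∈ ℕ, and let φ = (φ0, φ1, φ2) with each φi ∈ (0, 1/2). Define μ0_{x,j} = C(x,j)·(1 − 2φ0)^x / B(x,φ) for 2 ≤ x and 1 ≤ j ≤ x − 1, μ1_{x,j} = C(x,j)·(1 − 2φ1)^x / B(x,φ) for 1 ≤ x and 1 ≤ j ≤ x, μ2_{x,j} = C(x,j)·(1 − 2φ2)^x / B(x,φ) for 0 ≤ j ≤ x, and set all other μi_{x,j} = 0. If λ·φi = Σ_{x=0}^{X} x·p_x·Σ_{j=0}^{x} μi_{x,j} holds for i = 0, 1, 2, then ∏_{x=0}^{X} ∏_{j=0}^{x} ∏_{i=0}^{2} ( μi_{x,j} / C(x,j) )^( μi_{x,j} · p_x ) = (1 − 2φ0)^(λφ0) · (1 − 2φ1)^(λφ1) · (1 − 2φ2)^(λφ2) / ∏_{x=0}^{X} B(x,φ)^(p_x), where factors with μi_{x,j} = 0 are taken equal to 1 (convention 0^0 = 1). -/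

import Mathlib

open scoped Classical

/-- The Poisson probability `p(x, λ) = e^(−λ) λ^x / x!`. -/
noncomputable def poisson (lam : ℝ) (x : ℕ) : ℝ :=
  Real.exp (-lam) * lam ^ x / (Nat.factorial x)

/-- `A0(x, φ) = max(0, 2^x − 2) (1 − 2φ0)^x`. -/
noncomputable def A0 (phi0 : ℝ) (x : ℕ) : ℝ := max 0 ((2 : ℝ) ^ x - 2) * (1 - 2 * phi0) ^ x

/-- `A1(x, φ) = (2^x − 1) (1 − 2φ1)^x`. -/
noncomputable def A1 (phi1 : ℝ) (x : ℕ) : ℝ := ((2 : ℝ) ^ x - 1) * (1 - 2 * phi1) ^ x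

/-- `A2(x, φ) = 2^x (1 − 2φ2)^x`. -/
noncomputable def A2 (phi2 : ℝ) (x : ℕ) : ℝ := (2 : ℝ) ^ x * (1 - 2 * phi2) ^ x

/-- `B(x, φ) = A0(x, φ) + A1(x, φ) + A2(x, φ)`. -/
noncomputable def B (phi : Fin 3 → ℝ) (x : ℕ) : ℝ :=
  A0 (phi 0) x + A1 (phi 1) x + A2 (phi 2) x

/-- The index set of the nonzero `μ`'s: `i = 0` with `2 ≤ x`, `1 ≤ j ≤ x − 1`;
`i = 1` with `1 ≤ x`, `1 ≤ j ≤ x`; `i = 2` with `0 ≤ j ≤ x`. -/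
def muDom (i : Fin 3) (x j : ℕ) : Prop :=
  (i = 0 ∧ 2 ≤ x ∧ 1 ≤ j ∧ j ≤ x - 1) ∨
  (i = 1 ∧ 1 ≤ x ∧ 1 ≤ j ∧ j ≤ x) ∨
  (i = 2 ∧ j ≤ x)

/-- `μ^i_{x,j} = C(x,j) (1 − 2φ_i)^x / B(x, φ)` on the admitted index set, `0` elsewhere. -/
noncomputable def mu (phi : Fin 3 → ℝ) (i : Fin 3) (x j : ℕ) : ℝ :=
  if muDom i x j then (Nat.choose x j : ℝ) * (1 - 2 * phi i) ^ x / B phi x else 0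

theorem B_pos {phi : Fin 3 → ℝ} (hphi : ∀ i, 0 < phi i ∧ phi i < 1 / 2) (x : ℕ) :
    0 < B phi x := by
  have h0 : 0 < 1 - 2 * phi 0 := by linarith [(hphi 0).2]
  have h1 : 0 < 1 - 2 * phi 1 := by linarith [(hphi 1).2]
  have h2 : 0 < 1 - 2 * phi 2 := by linarith [(hphi 2).2]
  have hx : (0 : ℝ) ≤ 2 ^ x - 1 := sub_nonneg.2 (one_le_pow₀ (by norm_num))
  have hA0 : 0 ≤ A0 (phi 0) x := mul_nonneg (le_max_left _ _) (by positivity)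
  have hA1 : 0 ≤ A1 (phi 1) x := mul_nonneg hx (by positivity)
  have hA2 : 0 < A2 (phi 2) x := by unfold A2; positivity
  unfold B
  linarith

theorem sum_range_choose_real (x : ℕ) :
    ∑ j ∈ Finset.range (x + 1), (Nat.choose x j : ℝ) = 2 ^ x := by
  exact_mod_cast Nat.sum_range_choose x

theorem sum_mu_zero (phi : Fin 3 → ℝ) (x : ℕ) :
    ∑ j ∈ Finset.range (x + 1), mu phi 0 x j = A0 (phi 0) x / B phi x := by
  rcases Nat.eq_zero_or_pos x with rfl | hx
  · simp [mu, muDom, A0]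
  have hmu : ∀ j ∈ Finset.range (x + 1), mu phi 0 x j =
      ((Nat.choose x j : ℝ) - (if j = 0 then 1 else 0) - (if j = x then 1 else 0)) *
        ((1 - 2 * phi 0) ^ x / B phi x) := by
    intro j hj
    rw [Finset.mem_range] at hj
    by_cases hj0 : j = 0
    · subst hj0
      simp [mu, muDom, hx.ne]
    by_cases hjx : j = x
    · subst hjx
      have : ¬ j ≤ j - 1 := by omega
      simp [mu, muDom, hj0, this]
    · have : muDom 0 x j := Or.inl ⟨rfl, by omega, by omega, by omega⟩
      simp [mu, this, hj0, hjx, mul_div_assoc]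
  have hpow : (2 : ℝ) ≤ 2 ^ x := le_self_pow₀ (by norm_num) hx.ne'
  rw [Finset.sum_congr rfl hmu, ← Finset.sum_mul, Finset.sum_sub_distrib,
    Finset.sum_sub_distrib, sum_range_choose_real, A0, max_eq_right (by linarith)]
  simp
  ring

theorem sum_mu_one (phi : Fin 3 → ℝ) (x : ℕ) :
    ∑ j ∈ Finset.range (x + 1), mu phi 1 x j = A1 (phi 1) x / B phi x := by
  have hmu : ∀ j ∈ Finset.range (x + 1), mu phi 1 x j =
      ((Nat.choose x j : ℝ) - (if j = 0 then 1 else 0)) *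
        ((1 - 2 * phi 1) ^ x / B phi x) := by
    intro j hj
    rw [Finset.mem_range] at hj
    by_cases hj0 : j = 0
    · subst hj0
      simp [mu, muDom]
    · have : muDom 1 x j := Or.inr (Or.inl ⟨rfl, by omega, by omega, by omega⟩)
      simp [mu, this, hj0, mul_div_assoc]
  rw [Finset.sum_congr rfl hmu, ← Finset.sum_mul, Finset.sum_sub_distrib,
    sum_range_choose_real, A1]
  simp
  ring

theorem sum_mu_two (phi : Fin 3 → ℝ) (x : ℕ) :
    ∑ j ∈ Finset.range (x + 1), mu phi 2 x j = A2 (phi 2) x / B phi x := by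
  have hmu : ∀ j ∈ Finset.range (x + 1), mu phi 2 x j =
      (Nat.choose x j : ℝ) * ((1 - 2 * phi 2) ^ x / B phi x) := by
    intro j hj
    rw [Finset.mem_range] at hj
    have : muDom 2 x j := Or.inr (Or.inr ⟨rfl, by omega⟩)
    simp [mu, this, mul_div_assoc]
  rw [Finset.sum_congr rfl hmu, ← Finset.sum_mul, sum_range_choose_real, A2, mul_div_assoc]

theorem sum_mu_eq_one {phi : Fin 3 → ℝ} (hphi : ∀ i, 0 < phi i ∧ phi i < 1 / 2) (x : ℕ) :
    ∑ i : Fin 3, ∑ j ∈ Finset.range (x + 1), mu phi i x j = 1 := by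
  rw [Fin.sum_univ_three, sum_mu_zero, sum_mu_one, sum_mu_two, ← add_div, ← add_div]
  exact div_self (B_pos hphi x).ne'

theorem mu_div_choose_rpow {phi : Fin 3 → ℝ} (hphi : ∀ i, 0 < phi i ∧ phi i < 1 / 2)
    (i : Fin 3) {x j : ℕ} (hj : j ≤ x) (p : ℝ) :
    (mu phi i x j / (Nat.choose x j : ℝ)) ^ (mu phi i x j * p) =
      Real.exp (mu phi i x j * p * (x * Real.log (1 - 2 * phi i) - Real.log (B phi x))) := by
  by_cases h : muDom i x j
  · have hq : 0 < 1 - 2 * phi i := by linarith [(hphi i).2]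
    have hB := B_pos hphi x
    have hC : (0 : ℝ) < Nat.choose x j := by exact_mod_cast Nat.choose_pos hj
    have hbase : mu phi i x j / (Nat.choose x j : ℝ) = (1 - 2 * phi i) ^ x / B phi x := by
      rw [mu, if_pos h]
      field_simp
    rw [hbase, Real.rpow_def_of_pos (by positivity), Real.log_div (by positivity) hB.ne',
      Real.log_pow, mul_comm]
  · simp [mu, h]

/-- If the `μ`'s defined by the Lagrange conditions satisfy the spread equations
`λ φ_i = Σ_{x≤X} x p_x Σ_{j≤x} μ^i_{x,j}` for `i = 0, 1, 2`, then
`∏_{x,j,i} (μ^i_{x,j}/C(x,j))^(μ^i_{x,j} p_x)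
  = ∏_i (1 − 2φ_i)^(λ φ_i) / ∏_{x≤X} B(x,φ)^(p_x)`
(factors with `μ^i_{x,j} = 0` count as `1`). -/
theorem stmt13 (lam : ℝ) (hlam : 0 < lam) (X : ℕ) (phi : Fin 3 → ℝ)
    (hphi : ∀ i, 0 < phi i ∧ phi i < 1 / 2)
    (heq : ∀ i, lam * phi i =
      ∑ x ∈ Finset.range (X + 1), (x : ℝ) * poisson lam x *
        ∑ j ∈ Finset.range (x + 1), mu phi i x j) :
    ∏ x ∈ Finset.range (X + 1), ∏ j ∈ Finset.range (x + 1), ∏ i : Fin 3,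
        (mu phi i x j / (Nat.choose x j : ℝ)) ^ (mu phi i x j * poisson lam x)
      = (1 - 2 * phi 0) ^ (lam * phi 0) * (1 - 2 * phi 1) ^ (lam * phi 1) *
          (1 - 2 * phi 2) ^ (lam * phi 2) /
        ∏ x ∈ Finset.range (X + 1), (B phi x) ^ (poisson lam x) := by
  have hq : ∀ i, 0 < 1 - 2 * phi i := fun i => by linarith [(hphi i).2]
  have hlhs : ∀ x ∈ Finset.range (X + 1), ∏ j ∈ Finset.range (x + 1), ∏ i : Fin 3,
      (mu phi i x j / (Nat.choose x j : ℝ)) ^ (mu phi i x j * poisson lam x) =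
      Real.exp (∑ i : Fin 3, (x * poisson lam x * ∑ j ∈ Finset.range (x + 1), mu phi i x j) *
        Real.log (1 - 2 * phi i) - Real.log (B phi x) * poisson lam x) := by
    intro x _
    rw [Finset.prod_congr rfl fun j hj => Finset.prod_congr rfl fun i _ =>
      mu_div_choose_rpow hphi i (Nat.lt_succ_iff.1 (Finset.mem_range.1 hj)) (poisson lam x)]
    simp_rw [← Real.exp_sum]
    congr 1
    rw [Finset.sum_comm]
    simp_rw [← Finset.sum_mul]
    have h1 := sum_mu_eq_one hphi x
    rw [Fin.sum_univ_three] at h1 ⊢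
    rw [Fin.sum_univ_three]
    linear_combination (-(Real.log (B phi x) * poisson lam x)) * h1
  rw [Finset.prod_congr rfl hlhs, ← Real.exp_sum, Finset.sum_sub_distrib, Finset.sum_comm]
  simp_rw [← Finset.sum_mul, ← heq]
  rw [Real.exp_sub, Fin.sum_univ_three, Real.exp_add, Real.exp_add, Real.exp_sum]
  simp only [Real.rpow_def_of_pos (hq _), Real.rpow_def_of_pos (B_pos hphi _), mul_comm]
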